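/- Suppose there exists h > 0 such that lim_{n→∞} (∫_{nh}^{(n+1)h} ‖σ(s)‖_F² ds) · log n = +∞. Then S_h'(ε) = +∞ for all ε > 0. -/

import Mathlib

open MeasureTheory Filter

/-- The squared Frobenius norm of `σ(s)`. -/
noncomputable def F2 {d r : ℕ} (σ : ℝ → Matrix (Fin d) (Fin r) ℝ) (s : ℝ) : ℝ :=
  ∑ i : Fin d, ∑ j : Fin r, (σ s i j) ^ 2

/-- `θ_h(n)² = ∫_{nh}^{(n+1)h} ‖σ(s)‖_F² ds`. -/
noncomputable def theta2 {d r : ℕ} (σ : ℝ → Matrix (Fin d) (Fin r) ℝ) (h : ℝ) (n : ℕ) : ℝ :=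
  ∫ s in ((n : ℝ) * h)..(((n : ℝ) + 1) * h), F2 σ s

/-- The `n`-th summand of `S_h'(ε)`, taken to be `0` when `θ_h(n) = 0`. -/
noncomputable def Sterm {d r : ℕ} (σ : ℝ → Matrix (Fin d) (Fin r) ℝ) (h ε : ℝ) (n : ℕ) : ℝ :=
  if theta2 σ h n = 0 then 0
  else Real.sqrt (theta2 σ h n) * Real.exp (-(ε ^ 2) / (2 * theta2 σ h n))

/-- `S_h'(ε) = ∑_{n=1}^∞ θ_h(n) exp(-ε²/(2θ_h(n)²)) < +∞`.
Since all summands are nonnegative, finiteness is expressed as summability. -/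
def SFinite {d r : ℕ} (σ : ℝ → Matrix (Fin d) (Fin r) ℝ) (h ε : ℝ) : Prop :=
  Summable fun n : ℕ => Sterm σ h ε (n + 1)

theorem one_div_le_sqrt_mul_exp {T ε x : ℝ} (hx : 1 < x)
    (h : ε ^ 2 + 1 ≤ T * Real.log x) :
    0 < T ∧ 1 / x ≤ Real.sqrt T * Real.exp (-(ε ^ 2) / (2 * T)) := by
  have hx0 : 0 < x := by linarith
  have hL : 0 < Real.log x := Real.log_pos hx
  have hLx : Real.log x ≤ x := (Real.log_le_sub_one_of_pos hx0).trans (by linarith)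
  have hT : 0 < T := pos_of_mul_pos_left (by nlinarith [sq_nonneg ε]) hL.le
  have hxT : 1 / x ≤ T := by
    rw [div_le_iff₀ hx0]
    nlinarith [sq_nonneg ε]
  have hexp : Real.sqrt (1 / x) ≤ Real.exp (-(ε ^ 2) / (2 * T)) := by
    have hsqrt : Real.sqrt (1 / x) = Real.exp (-Real.log x / 2) := by
      rw [Real.exp_half, Real.exp_neg, Real.exp_log hx0, one_div]
    rw [hsqrt, Real.exp_le_exp, div_le_div_iff₀ two_pos (by positivity)]
    linarith
  refine ⟨hT, ?_⟩
  calc 1 / x = Real.sqrt (1 / x) * Real.sqrt (1 / x) :=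
        (Real.mul_self_sqrt (by positivity)).symm
    _ ≤ Real.sqrt T * Real.exp (-(ε ^ 2) / (2 * T)) :=
        mul_le_mul (Real.sqrt_le_sqrt hxT) hexp (Real.sqrt_nonneg _) (Real.sqrt_nonneg _)

theorem stmt_12 (d r : ℕ) (hd : 1 ≤ d) (hr : 1 ≤ r)
    (σ : ℝ → Matrix (Fin d) (Fin r) ℝ) (hσ : ContinuousOn σ (Set.Ici 0))
    (h : ℝ) (hh : 0 < h)
    (hlim : Tendsto (fun n : ℕ => theta2 σ h n * Real.log n) atTop atTop) :
    ∀ ε : ℝ, 0 < ε → ¬ SFinite σ h ε := by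
  intro ε _ hS
  have hS' : Summable (Sterm σ h ε) := (summable_nat_add_iff 1).mp hS
  refine Real.not_summable_one_div_natCast (Summable.of_norm_bounded_eventually_nat hS' ?_)
  filter_upwards [hlim.eventually_ge_atTop (ε ^ 2 + 1), eventually_gt_atTop 1] with n hn hn1
  obtain ⟨hT, hle⟩ := one_div_le_sqrt_mul_exp (Nat.one_lt_cast.mpr hn1) hn
  rw [Real.norm_of_nonneg (by positivity), Sterm, if_neg hT.ne']
  exact hle
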